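/- Let p be a prime and G a finite p-group whose Chermak–Delgado lattice CD(G) is a quasi-antichain of width w (so CD(G) consists of a maximum, a minimum, and exactly w atoms). Suppose exactly t of the atoms of CD(G) are abelian subgroups and t > 2. Then there exist positive integers a and b such that w = p^a + 1, t = p^b + 1, and either a = b or a = 2b. -/

import Mathlib

/-- The Chermak–Delgado measure of a subgroup `H` of `G`: `|H| * |C_G(H)|`. -/
noncomputable def cdMeasure (G : Type*) [Group G] (H : Subgroup G) : ℕ :=
  Nat.card H * Nat.card (Subgroup.centralizer (H : Set G))

/-- The maximal Chermak–Delgado measure of `G`. -/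
noncomputable def cdMax (G : Type*) [Group G] : ℕ :=
  sSup (Set.range (cdMeasure G))

/-- The Chermak–Delgado lattice of `G`, as the set of subgroups attaining
the maximal Chermak–Delgado measure. -/
def CD (G : Type*) [Group G] : Set (Subgroup G) :=
  {H : Subgroup G | cdMeasure G H = cdMax G}



theorem cdaux_field (F : Type*) [Field F] [Finite F] (p : ℕ) [Fact p.Prime] [CharP F p]
    (σ : F →+* F) (hinv : ∀ x, σ (σ x) = x) :
    ∃ a b : ℕ, 0 < a ∧ 0 < b ∧ Nat.card F = p ^ a ∧ Nat.card {x // σ x = x} = p ^ b ∧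
      (a = b ∨ a = 2 * b) := by
  classical
  have hp := (Fact.out : p.Prime)
  let K : Subfield F := RingHom.eqLocusField σ (RingHom.id F)
  have hK : ∀ x, x ∈ K ↔ σ x = x := fun x => Iff.rfl
  have hcK : Nat.card {x // σ x = x} = Nat.card K := rfl
  rw [hcK]
  cases nonempty_fintype F
  have : Fintype K := Fintype.ofFinite K
  obtain ⟨b, -, hb⟩ := FiniteField.card K p
  have hpow : Nat.card F = Nat.card K ^ Module.finrank K F := by
    rw [Module.natCard_eq_pow_finrank (K := K) (V := F)]
  have hb' : Nat.card K = p ^ (b : ℕ) := by rw [Nat.card_eq_fintype_card, hb]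
  have hle : Nat.card F ≤ Nat.card K ^ 2 := by
    by_cases hid : ∀ y, σ y = y
    · have : Nat.card F = Nat.card K :=
        Nat.card_congr ⟨fun x => ⟨x, hid x⟩, fun x => x, fun _ => rfl, fun _ => rfl⟩
      rw [this]
      exact Nat.le_self_pow (by norm_num) _
    · push Not at hid
      obtain ⟨y, hy⟩ := hid
      have hmem : ∀ x, x + σ x ∈ K := fun x => by
        rw [hK, map_add, hinv, add_comm]
      rw [sq, ← Nat.card_prod]
      refine Nat.card_le_card_of_injective
        (fun x : F => ((⟨x + σ x, hmem x⟩, ⟨y * x + σ (y * x), hmem _⟩) : K × K)) ?_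
      intro u v huv
      simp only [Prod.mk.injEq, Subtype.mk.injEq, map_mul] at huv
      obtain ⟨h1, h2⟩ := huv
      have : (y - σ y) * (u - v) = 0 := by linear_combination h2 - σ y * h1
      rcases mul_eq_zero.1 this with h | h
      · exact absurd (sub_eq_zero.1 h).symm hy
      · exact sub_eq_zero.1 h
  have hK2 : 1 < Nat.card K := Finite.one_lt_card
  have hn2 : Module.finrank K F ≤ 2 := by
    rw [hpow] at hle
    exact (Nat.pow_le_pow_iff_right hK2).1 hle
  have hn0 : 0 < Module.finrank K F := Module.finrank_pos
  refine ⟨b * Module.finrank K F, b, Nat.mul_pos b.pos hn0, b.pos, ?_, hb', ?_⟩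
  · rw [hpow, hb', pow_mul]
  · interval_cases Module.finrank K F
    · left; simp
    · right; ring

theorem cdaux_ring (R : Type*) [Ring R] [Finite R] [Nontrivial R] [NoZeroDivisors R]
    (p : ℕ) [Fact p.Prime] (n : ℕ) (hn : (p : R) ^ n = 0)
    (σ : R → R) (hone : σ 1 = 1) (hadd : ∀ x y, σ (x + y) = σ x + σ y)
    (hmul : ∀ x y, σ (x * y) = σ y * σ x) (hinv : ∀ x, σ (σ x) = x) :
    ∃ a b : ℕ, 0 < a ∧ 0 < b ∧ Nat.card R = p ^ a ∧ Nat.card {x // σ x = x} = p ^ b ∧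
      (a = b ∨ a = 2 * b) := by
  have : IsDomain R := NoZeroDivisors.to_isDomain R
  have hF : IsField R := Finite.isDomain_to_isField R
  have hp0 : (p : R) = 0 := by
    by_contra h
    exact pow_ne_zero n h hn
  have hchar : CharP R p := by
    obtain ⟨q, hq⟩ := CharP.exists R
    have hdvd : q ∣ p := (CharP.cast_eq_zero_iff R q p).1 hp0
    rcases (Nat.dvd_prime Fact.out).1 hdvd with h | h
    · exact absurd h (CharP.char_ne_one R q)
    · exact h ▸ hq
  let _ : Field R := hF.toField
  let s : R →+* R :=
    { toFun := σ, map_one' := hone, map_add' := hadd,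
      map_mul' := fun x y => by rw [hmul, mul_comm],
      map_zero' := by simpa using hadd 0 0 }
  exact cdaux_field R p s hinv

/-- The orthogonal of a submodule with respect to a bilinear map. -/
def cdPerp {U T : Type*} [AddCommGroup U] [AddCommGroup T] (ω : U →ₗ[ℤ] U →ₗ[ℤ] T)
    (K : Submodule ℤ U) : Submodule ℤ U where
  carrier := {y | ∀ x ∈ K, ω x y = 0}
  add_mem' := fun {a b} ha hb x hx => by rw [map_add, ha x hx, hb x hx, add_zero]
  zero_mem' := fun x _ => map_zero _
  smul_mem' := fun c a ha x hx => by rw [map_smul, ha x hx, smul_zero]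

/-- Endomorphisms possessing an adjoint for a bilinear map. -/
def cdAdj {V T : Type*} [AddCommGroup V] [AddCommGroup T] (β : V → V → T)
    (φ ψ : Module.End ℤ V) : Prop := ∀ x y, β (φ x) y = β x (ψ y)

theorem cdaux_core {U T V : Type*} [AddCommGroup U] [Finite U] [AddCommGroup T]
    [AddCommGroup V] [Finite V] [Nontrivial V]
    (p : ℕ) [Fact p.Prime] (n : ℕ) (hp : Nat.card V = p ^ n)
    (ω : U →ₗ[ℤ] U →ₗ[ℤ] T) (halt : ∀ x, ω x x = 0)
    (hmax : ∀ K : Submodule ℤ U, Nat.card K * Nat.card (cdPerp ω K) ≤ Nat.card U)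
    (hc : ∀ K K' : Submodule ℤ U, Nat.card K * Nat.card (cdPerp ω K) = Nat.card U →
      Nat.card K' * Nat.card (cdPerp ω K') = Nat.card U → K ≠ ⊥ → K ≠ ⊤ → K' ≠ ⊥ → K' ≠ ⊤ →
      K ≠ K' → IsCompl K K')
    (ι θ : V →ₗ[ℤ] U) (hι : Function.Injective ι) (hθ : Function.Injective θ)
    (hcompl : IsCompl (LinearMap.range ι) (LinearMap.range θ))
    (hιι : ∀ x y, ω (ι x) (ι y) = 0) (hθθ : ∀ x y, ω (θ x) (θ y) = 0)
    (hsym : ∀ x y, ω (ι x) (θ y) = ω (ι y) (θ x)) :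
    ∃ a b : ℕ, 0 < a ∧ 0 < b ∧
      {K : Submodule ℤ U | Nat.card K * Nat.card (cdPerp ω K) = Nat.card U ∧
        K ≠ ⊥ ∧ K ≠ ⊤}.ncard = p ^ a + 1 ∧
      {K : Submodule ℤ U | Nat.card K * Nat.card (cdPerp ω K) = Nat.card U ∧
        K ≠ ⊥ ∧ K ≠ ⊤ ∧ K ≤ cdPerp ω K}.ncard = p ^ b + 1 ∧
      (a = b ∨ a = 2 * b) := by
  classical
  have hskew : ∀ x y, ω x y = - ω y x := by
    intro x y
    have h := halt (x + y)
    simp only [map_add, LinearMap.add_apply, halt, zero_add, add_zero] at h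
    exact eq_neg_of_add_eq_zero_right h
  have hmem : ∀ (K : Submodule ℤ U) y, y ∈ cdPerp ω K ↔ ∀ x ∈ K, ω x y = 0 := fun K y => Iff.rfl
  -- nondegeneracy
  have hnd : ∀ y, (∀ x, ω x y = 0) → y = 0 := by
    intro y hy
    have h1 := hmax ⊤
    have h2 : Nat.card (⊤ : Submodule ℤ U) = Nat.card U := Nat.card_congr Submodule.topEquiv.toEquiv
    rw [h2] at h1
    have h3 : Nat.card (cdPerp ω ⊤) ≤ 1 := by
      by_contra h
      have : 0 < Nat.card U := Nat.card_pos
      nlinarith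
    have := Finite.card_le_one_iff_subsingleton.1 h3
    have h4 : (⟨y, fun x _ => hy x⟩ : cdPerp ω ⊤) = 0 := Subsingleton.elim _ _
    exact congrArg Subtype.val h4
  have hpos : ∀ K : Submodule ℤ U, 0 < Nat.card K := fun K => Nat.card_pos
  have hUpos : 0 < Nat.card U := Nat.card_pos
  have hcle : ∀ K K' : Submodule ℤ U, K ≤ K' → Nat.card K ≤ Nat.card K' := fun K K' h =>
    Nat.card_le_card_of_injective _ (Submodule.inclusion_injective h)
  have hceq : ∀ K K' : Submodule ℤ U, K ≤ K' → Nat.card K' ≤ Nat.card K → K = K' := by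
    intro K K' h h'
    apply SetLike.coe_injective
    exact Set.eq_of_subset_of_ncard_le h h' (Set.toFinite _)
  have hpp : ∀ K : Submodule ℤ U, K ≤ cdPerp ω (cdPerp ω K) := by
    intro K x hx y hy
    rw [hskew, hy x hx, neg_zero]
  have hctop : Nat.card (⊤ : Submodule ℤ U) = Nat.card U :=
    Nat.card_congr Submodule.topEquiv.toEquiv
  have hppeq : ∀ K : Submodule ℤ U, Nat.card K * Nat.card (cdPerp ω K) = Nat.card U →
      cdPerp ω (cdPerp ω K) = K := by
    intro K hK
    refine (hceq _ _ (hpp K) ?_).symm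
    have h1 := hmax (cdPerp ω K)
    rw [← hK, mul_comm (Nat.card K)] at h1
    exact Nat.le_of_mul_le_mul_left h1 (hpos _)
  have hperpL : ∀ K : Submodule ℤ U, Nat.card K * Nat.card (cdPerp ω K) = Nat.card U →
      Nat.card (cdPerp ω K) * Nat.card (cdPerp ω (cdPerp ω K)) = Nat.card U := by
    intro K hK
    rw [hppeq K hK, mul_comm, hK]
  have hperpbot : ∀ K : Submodule ℤ U, Nat.card K * Nat.card (cdPerp ω K) = Nat.card U →
      K ≠ ⊤ → cdPerp ω K ≠ ⊥ := by
    intro K hK h1 h2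
    rw [h2] at hK
    apply h1
    refine hceq _ _ le_top ?_
    rw [hctop, ← hK]; simp
  have hperptop : ∀ K : Submodule ℤ U, Nat.card K * Nat.card (cdPerp ω K) = Nat.card U →
      K ≠ ⊥ → cdPerp ω K ≠ ⊤ := by
    intro K hK h1 h2
    rw [h2, hctop] at hK
    apply h1
    refine (hceq _ _ bot_le ?_).symm
    have : Nat.card K = 1 := Nat.eq_of_mul_eq_mul_right hUpos (by rw [hK, one_mul])
    rw [this]; simp
  -- coordinates
  have hdis : ∀ x y, ι x + θ y = 0 → x = 0 ∧ y = 0 := by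
    intro x y h
    have h1 : ι x ∈ LinearMap.range ι ⊓ LinearMap.range θ :=
      ⟨⟨x, rfl⟩, ⟨-y, by rw [map_neg]; exact (eq_neg_of_add_eq_zero_left h).symm⟩⟩
    rw [hcompl.inf_eq_bot, Submodule.mem_bot] at h1
    rw [h1, zero_add] at h
    exact ⟨hι (by rw [h1, map_zero]), hθ (by rw [h, map_zero])⟩
  have hdis2 : ∀ x y x' y', ι x + θ y = ι x' + θ y' → x = x' ∧ y = y' := by
    intro x y x' y' h
    have := hdis (x - x') (y - y') (by rw [map_sub, map_sub]; rw [← sub_eq_zero] at h; rw [← h]; abel)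
    exact ⟨sub_eq_zero.1 this.1, sub_eq_zero.1 this.2⟩
  have hcov : ∀ u, ∃ x y, ι x + θ y = u := by
    intro u
    have : u ∈ LinearMap.range ι ⊔ LinearMap.range θ := by rw [hcompl.sup_eq_top]; trivial
    obtain ⟨_, ⟨x, rfl⟩, _, ⟨y, rfl⟩, h⟩ := Submodule.mem_sup.1 this
    exact ⟨x, y, h⟩
  have hcU : Nat.card U = Nat.card V * Nat.card V := by
    rw [← Nat.card_prod]
    refine (Nat.card_eq_of_bijective (fun z : V × V => ι z.1 + θ z.2) ⟨?_, ?_⟩).symm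
    · rintro ⟨a, b⟩ ⟨c, d⟩ h
      obtain ⟨h1, h2⟩ := hdis2 _ _ _ _ h
      exact Prod.ext h1 h2
    · intro u
      obtain ⟨x, y, h⟩ := hcov u
      exact ⟨(x, y), h⟩
  set β : V → V → T := fun x y => ω (ι x) (θ y) with hβ
  have hβnd : ∀ y, (∀ x, β x y = 0) → y = 0 := by
    intro y hy
    apply hθ
    rw [map_zero]
    apply hnd
    intro u
    obtain ⟨x, z, rfl⟩ := hcov u
    rw [map_add, LinearMap.add_apply, hθθ, add_zero]
    exact hy x
  have hβs : ∀ x y, β x y = β y x := hsym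
  have hβadd : ∀ x y z, β x (y + z) = β x y + β x z := fun x y z => by
    simp only [hβ, map_add]
  have hβadd' : ∀ x y z, β (x + y) z = β x z + β y z := fun x y z => by
    simp only [hβ, map_add, LinearMap.add_apply]
  have hβneg : ∀ x y, β x (-y) = - β x y := fun x y => by simp only [hβ, map_neg]
  have hβneg' : ∀ x y, β (-x) y = - β x y := fun x y => by
    simp only [hβ, map_neg, LinearMap.neg_apply]
  have hβz : ∀ x, β x 0 = 0 := fun x => by simp only [hβ, map_zero]
  have hβz' : ∀ x, β 0 x = 0 := fun x => by rw [hβs, hβz]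
  have huniq : ∀ φ ψ ψ', cdAdj β φ ψ → cdAdj β φ ψ' → ψ = ψ' := by
    intro φ ψ ψ' h h'
    ext y
    rw [← sub_eq_zero]
    apply hβnd
    intro x
    rw [sub_eq_add_neg, hβadd, hβneg, ← h, ← h', add_neg_cancel]
  have hadjsymm : ∀ φ ψ, cdAdj β φ ψ → cdAdj β ψ φ := by
    intro φ ψ h x y
    rw [hβs, ← h, hβs]
  let R : Subring (Module.End ℤ V) :=
    { carrier := {φ | ∃ ψ, cdAdj β φ ψ}
      mul_mem' := by
        rintro a b ⟨a', ha⟩ ⟨b', hb⟩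
        exact ⟨b' * a', fun x y => by
          rw [Module.End.mul_apply, Module.End.mul_apply, ha, hb]⟩
      one_mem' := ⟨1, fun x y => rfl⟩
      add_mem' := by
        rintro a b ⟨a', ha⟩ ⟨b', hb⟩
        exact ⟨a' + b', fun x y => by
          rw [LinearMap.add_apply, LinearMap.add_apply, hβadd, hβadd', ha, hb]⟩
      zero_mem' := ⟨0, fun x y => by
        rw [LinearMap.zero_apply, LinearMap.zero_apply, hβz, hβz']⟩
      neg_mem' := by
        rintro a ⟨a', ha⟩
        exact ⟨-a', fun x y => by
          rw [LinearMap.neg_apply, LinearMap.neg_apply, hβneg, hβneg', ha]⟩ }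
  have hRmem : ∀ φ : Module.End ℤ V, φ ∈ R ↔ ∃ ψ, cdAdj β φ ψ := fun φ => Iff.rfl
  -- graphs
  let Γ : Module.End ℤ V → Submodule ℤ U := fun φ => LinearMap.range (ι + θ ∘ₗ φ)
  have hΓmem : ∀ φ u, u ∈ Γ φ ↔ ∃ x, ι x + θ (φ x) = u := fun φ u => Iff.rfl
  have hΓcard : ∀ φ, Nat.card (Γ φ) = Nat.card V := by
    intro φ
    refine (Nat.card_congr (LinearEquiv.ofInjective (ι + θ ∘ₗ φ) ?_).toEquiv).symm
    intro x y h
    exact (hdis2 _ _ _ _ h).1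
  have hω : ∀ x y x' y', ω (ι x + θ y) (ι x' + θ y') = β x y' - β y x' := by
    intro x y x' y'
    simp only [map_add, LinearMap.add_apply, hιι, hθθ, zero_add, add_zero]
    rw [hskew (θ y) (ι x'), hsym x' y, add_comm, sub_eq_add_neg]
  have hΓperp : ∀ φ ψ, Γ ψ ≤ cdPerp ω (Γ φ) ↔ cdAdj β φ ψ := by
    intro φ ψ
    constructor
    · intro h x y
      have := h ((hΓmem ψ _).2 ⟨y, rfl⟩) _ ((hΓmem φ _).2 ⟨x, rfl⟩)
      rw [hω, sub_eq_zero] at this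
      exact this.symm
    · rintro h _ ⟨y, rfl⟩ _ ⟨x, rfl⟩
      have := hω x (φ x) y (ψ y)
      rw [h, sub_self] at this
      exact this
  have hV1 : 1 < Nat.card V := Finite.one_lt_card
  have hΓL : ∀ φ ψ, cdAdj β φ ψ →
      Nat.card (Γ φ) * Nat.card (cdPerp ω (Γ φ)) = Nat.card U := by
    intro φ ψ h
    refine le_antisymm (hmax _) ?_
    have := hcle _ _ ((hΓperp φ ψ).2 h)
    rw [hΓcard] at this
    rw [hcU, hΓcard]
    exact Nat.mul_le_mul_left _ this
  have hbt : ∀ K : Submodule ℤ U, Nat.card K = Nat.card V → K ≠ ⊥ ∧ K ≠ ⊤ := by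
    intro K hK
    constructor
    · rintro rfl
      simp at hK
      omega
    · rintro rfl
      rw [hctop, hcU] at hK
      nlinarith
  have hB : Nat.card (LinearMap.range θ) = Nat.card V :=
    (Nat.card_congr (LinearEquiv.ofInjective θ hθ).toEquiv).symm
  have hBiso : LinearMap.range θ ≤ cdPerp ω (LinearMap.range θ) := by
    rintro _ ⟨y, rfl⟩ _ ⟨x, rfl⟩
    exact hθθ x y
  have hBL : Nat.card (LinearMap.range θ) * Nat.card (cdPerp ω (LinearMap.range θ)) =
      Nat.card U := by
    refine le_antisymm (hmax _) ?_
    have := hcle _ _ hBiso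
    rw [hB] at this
    rw [hcU, hB]
    exact Nat.mul_le_mul_left _ this
  have hBB : cdPerp ω (LinearMap.range θ) = LinearMap.range θ := by
    refine (hceq _ _ hBiso ?_).symm
    have h := hBL
    rw [hcU, hB] at h
    rw [hB, Nat.eq_of_mul_eq_mul_left (by omega) h]
  -- complements of B are graphs
  have hgraph : ∀ D : Submodule ℤ U, IsCompl D (LinearMap.range θ) → ∃ φ, D = Γ φ := by
    intro D hD
    have hex : ∀ x, ∃ y, ι x + θ y ∈ D := by
      intro x
      have : ι x ∈ D ⊔ LinearMap.range θ := by rw [hD.sup_eq_top]; trivial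
      obtain ⟨d, hd, _, ⟨y, rfl⟩, h⟩ := Submodule.mem_sup.1 this
      exact ⟨-y, by rw [← h, map_neg, add_neg_cancel_right]; exact hd⟩
    have hun : ∀ y, θ y ∈ D → y = 0 := by
      intro y hy
      have : θ y ∈ D ⊓ LinearMap.range θ := ⟨hy, ⟨y, rfl⟩⟩
      rw [hD.inf_eq_bot, Submodule.mem_bot] at this
      exact hθ (by rw [this, map_zero])
    have hun2 : ∀ x y y', ι x + θ y ∈ D → ι x + θ y' ∈ D → y = y' := by
      intro x y y' h h'
      rw [← sub_eq_zero]
      apply hun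
      have := D.sub_mem h h'
      rwa [add_sub_add_left_eq_sub, ← map_sub] at this
    choose f hf using hex
    let φ : Module.End ℤ V :=
      (AddMonoidHom.mk' f (fun a b => by
        apply hun2 (a + b) _ _ (hf _)
        have := D.add_mem (hf a) (hf b)
        rw [map_add, map_add]
        rwa [add_add_add_comm] at this)).toIntLinearMap
    refine ⟨φ, le_antisymm ?_ ?_⟩
    · intro d hd
      obtain ⟨x, y, rfl⟩ := hcov d
      have : y = f x := hun2 x _ _ hd (hf x)
      exact ⟨x, by rw [this]; rfl⟩
    · rintro _ ⟨x, rfl⟩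
      exact hf x
  -- the star map
  choose s hs using fun r : R => (hRmem r).1 r.2
  let σ : R → R := fun r => ⟨s r, (hRmem _).2 ⟨r, hadjsymm _ _ (hs r)⟩⟩
  have hσ : ∀ r r' : R, cdAdj β r r' → σ r = r' := fun r r' h =>
    Subtype.ext (huniq _ _ _ (hs r) h)
  have hσ' : ∀ r : R, cdAdj β r (σ r) := fun r => hs r
  have hσfix : ∀ r : R, σ r = r ↔ cdAdj β r r := fun r =>
    ⟨fun h => by have := hσ' r; rwa [h] at this, hσ r r⟩
  have hfinEnd : Finite (Module.End ℤ V) := Finite.of_injective (fun f : Module.End ℤ V => (f : V → V)) DFunLike.coe_injective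
  have hinj : ∀ φ ψ, cdAdj β φ ψ → φ ≠ 0 → ∀ x, φ x = 0 → x = 0 := by
    intro φ ψ h h0 x hx
    have h00 : cdAdj β (0 : Module.End ℤ V) 0 := fun x y => by
      rw [LinearMap.zero_apply, LinearMap.zero_apply, hβz, hβz']
    have hne : Γ φ ≠ Γ 0 := by
      intro he
      apply h0
      ext y
      have : ι y + θ (φ y) ∈ Γ 0 := by rw [← he]; exact ⟨y, rfl⟩
      obtain ⟨z, hz⟩ := (hΓmem _ _).1 this
      have := hdis2 _ _ _ _ hz
      rw [← this.2]
      rfl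
    have hcc := hc _ _ (hΓL φ ψ h) (hΓL 0 0 h00) (hbt _ (hΓcard _)).1 (hbt _ (hΓcard _)).2
      (hbt _ (hΓcard _)).1 (hbt _ (hΓcard _)).2 hne
    have : ι x ∈ Γ φ ⊓ Γ 0 :=
      ⟨(hΓmem _ _).2 ⟨x, by rw [hx, map_zero, add_zero]⟩,
        (hΓmem _ _).2 ⟨x, by rw [LinearMap.zero_apply, map_zero, add_zero]⟩⟩
    rw [hcc.inf_eq_bot, Submodule.mem_bot] at this
    exact hι (by rw [this, map_zero])
  have hnzd : NoZeroDivisors R := by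
    constructor
    intro a b hab
    by_contra hcon
    push Not at hcon
    apply hcon.2
    apply Subtype.ext
    ext x
    refine hinj a (σ a) (hσ' a) (fun h => hcon.1 (Subtype.ext h)) _ ?_
    have := congrArg (fun r : R => (r : Module.End ℤ V) x) hab
    exact this
  obtain ⟨a, b, ha, hb, hca, hcb, hab⟩ := cdaux_ring R p n (by
      apply Subtype.ext
      ext x
      have : ((p : R) ^ n : R) = ((Nat.card V : ℕ) : R) := by rw [hp]; push_cast; rfl
      rw [this]
      have h2 : (((Nat.card V : ℕ) : R) : Module.End ℤ V) x = Nat.card V • x := by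
        simp
      rw [h2]
      exact card_nsmul_eq_zero') σ
    (hσ _ _ (fun x y => rfl))
    (fun r r' => hσ _ _ (fun x y => by
      have h1 := hσ' r x y
      have h2 := hσ' r' x y
      change β ((r : Module.End ℤ V) x + (r' : Module.End ℤ V) x) y =
        β x (((σ r : R) : Module.End ℤ V) y + ((σ r' : R) : Module.End ℤ V) y)
      rw [hβadd, hβadd', h1, h2]))
    (fun r r' => hσ _ _ (fun x y => by
      change β ((r : Module.End ℤ V) ((r' : Module.End ℤ V) x)) y =
        β x (((σ r' : R) : Module.End ℤ V) (((σ r : R) : Module.End ℤ V) y))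
      rw [hσ' r, hσ' r']))
    (fun r => hσ _ _ (hadjsymm _ _ (hσ' r)))
  have hΓinj : Function.Injective Γ := by
    intro φ ψ h
    ext x
    have : ι x + θ (φ x) ∈ Γ ψ := by rw [← h]; exact ⟨x, rfl⟩
    obtain ⟨z, hz⟩ := (hΓmem _ _).1 this
    have := hdis2 _ _ _ _ hz
    rw [← this.2, this.1]
  have hΓB : ∀ φ, Γ φ ≠ LinearMap.range θ := by
    intro φ h
    obtain ⟨x, hx⟩ := exists_ne (0 : V)
    have : ι x + θ (φ x) ∈ LinearMap.range θ := by rw [← h]; exact ⟨x, rfl⟩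
    obtain ⟨z, hz⟩ := this
    have := hdis2 0 z x (φ x) (by rw [hz, map_zero, zero_add])
    exact hx this.1.symm
  have hclass : ∀ D : Submodule ℤ U, Nat.card D * Nat.card (cdPerp ω D) = Nat.card U →
      D ≠ ⊥ → D ≠ ⊤ → D ≠ LinearMap.range θ → ∃ r : R, Γ r = D := by
    intro D hD h1 h2 h3
    obtain ⟨φ, hφ⟩ := hgraph D (hc _ _ hD hBL h1 h2 (hbt _ hB).1 (hbt _ hB).2 h3)
    have h4 : cdPerp ω D ≠ LinearMap.range θ := by
      intro h
      apply h3
      rw [← hppeq D hD, h, hBB]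
    obtain ⟨ψ, hψ⟩ := hgraph (cdPerp ω D) (hc _ _ (hperpL D hD) hBL (hperpbot D hD h2)
      (hperptop D hD h1) (hbt _ hB).1 (hbt _ hB).2 h4)
    refine ⟨⟨φ, ψ, ?_⟩, hφ.symm⟩
    rw [← hΓperp, ← hφ, ← hψ]
  refine ⟨a, b, ha, hb, ?_, ?_, hab⟩
  · have : {K : Submodule ℤ U | Nat.card K * Nat.card (cdPerp ω K) = Nat.card U ∧
        K ≠ ⊥ ∧ K ≠ ⊤} = insert (LinearMap.range θ) (Set.range (fun r : R => Γ r)) := by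
      ext D
      constructor
      · rintro ⟨h, h1, h2⟩
        by_cases h3 : D = LinearMap.range θ
        · exact Or.inl h3
        · exact Or.inr (hclass D h h1 h2 h3)
      · rintro (rfl | ⟨r, rfl⟩)
        · exact ⟨hBL, hbt _ hB⟩
        · exact ⟨hΓL _ _ (hσ' r), hbt _ (hΓcard _)⟩
    rw [this, Set.ncard_insert_of_notMem _ (Set.toFinite _), ← hca]
    · rw [← Set.image_univ, Set.ncard_image_of_injective, Set.ncard_univ]
      exact fun r r' h => Subtype.ext (hΓinj h)
    · rintro ⟨r, hr⟩
      exact hΓB _ hr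
  · have : {K : Submodule ℤ U | Nat.card K * Nat.card (cdPerp ω K) = Nat.card U ∧
        K ≠ ⊥ ∧ K ≠ ⊤ ∧ K ≤ cdPerp ω K} =
        insert (LinearMap.range θ) (Set.range (fun r : {x : R // σ x = x} => Γ r)) := by
      ext D
      constructor
      · rintro ⟨h, h1, h2, h5⟩
        by_cases h3 : D = LinearMap.range θ
        · exact Or.inl h3
        · obtain ⟨r, rfl⟩ := hclass D h h1 h2 h3
          exact Or.inr ⟨⟨r, (hσfix r).2 ((hΓperp _ _).1 h5)⟩, rfl⟩
      · rintro (rfl | ⟨r, rfl⟩)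
        · exact ⟨hBL, (hbt _ hB).1, (hbt _ hB).2, hBiso⟩
        · exact ⟨hΓL _ _ (hσ' r), (hbt _ (hΓcard _)).1, (hbt _ (hΓcard _)).2,
            (hΓperp _ _).2 ((hσfix _).1 r.2)⟩
    rw [this, Set.ncard_insert_of_notMem _ (Set.toFinite _), ← hcb]
    · rw [← Set.image_univ, Set.ncard_image_of_injective, Set.ncard_univ]
      exact fun r r' h => Subtype.ext (Subtype.ext (hΓinj h))
    · rintro ⟨r, hr⟩
      exact hΓB _ hr

theorem cdaux_lin {U T : Type*} [AddCommGroup U] [Finite U] [AddCommGroup T]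
    (p : ℕ) [Fact p.Prime] (n : ℕ) (hp : Nat.card U = p ^ n)
    (ω : U →ₗ[ℤ] U →ₗ[ℤ] T) (halt : ∀ x, ω x x = 0)
    (hmax : ∀ K : Submodule ℤ U, Nat.card K * Nat.card (cdPerp ω K) ≤ Nat.card U)
    (hc : ∀ K K' : Submodule ℤ U, Nat.card K * Nat.card (cdPerp ω K) = Nat.card U →
      Nat.card K' * Nat.card (cdPerp ω K') = Nat.card U → K ≠ ⊥ → K ≠ ⊤ → K' ≠ ⊥ → K' ≠ ⊤ →
      K ≠ K' → IsCompl K K')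
    (h3 : 2 < {K : Submodule ℤ U | Nat.card K * Nat.card (cdPerp ω K) = Nat.card U ∧
        K ≠ ⊥ ∧ K ≠ ⊤ ∧ K ≤ cdPerp ω K}.ncard) :
    ∃ a b : ℕ, 0 < a ∧ 0 < b ∧
      {K : Submodule ℤ U | Nat.card K * Nat.card (cdPerp ω K) = Nat.card U ∧
        K ≠ ⊥ ∧ K ≠ ⊤}.ncard = p ^ a + 1 ∧
      {K : Submodule ℤ U | Nat.card K * Nat.card (cdPerp ω K) = Nat.card U ∧
        K ≠ ⊥ ∧ K ≠ ⊤ ∧ K ≤ cdPerp ω K}.ncard = p ^ b + 1 ∧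
      (a = b ∨ a = 2 * b) := by
  classical
  have hskew : ∀ x y, ω x y = - ω y x := by
    intro x y
    have h := halt (x + y)
    simp only [map_add, LinearMap.add_apply, halt, zero_add, add_zero] at h
    exact eq_neg_of_add_eq_zero_right h
  obtain ⟨A, ⟨hA, hA1, hA2, hA3⟩, B, ⟨hB, hB1, hB2, hB3⟩, C, ⟨hC, hC1, hC2, hC3⟩, hAB, hAC, hBC⟩ :=
    (Set.two_lt_ncard (Set.toFinite _)).1 h3
  have cAB := hc A B hA hB hA1 hA2 hB1 hB2 hAB
  have cAC := hc A C hA hC hA1 hA2 hC1 hC2 hAC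
  have cBC := hc B C hB hC hB1 hB2 hC1 hC2 hBC
  have hdj : ∀ (K K' : Submodule ℤ U), IsCompl K K' → ∀ x, x ∈ K → x ∈ K' → x = 0 := by
    intro K K' h x hx hx'
    have : x ∈ K ⊓ K' := ⟨hx, hx'⟩
    rwa [h.inf_eq_bot, Submodule.mem_bot] at this
  let θ : A →ₗ[ℤ] U := - ((B.projection C cBC) ∘ₗ A.subtype)
  have hθB : ∀ x, θ x ∈ B := fun x => B.neg_mem (Submodule.projection_apply_mem cBC _)
  have hθC : ∀ x : A, (x : U) + θ x ∈ C := fun x => by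
    have := Submodule.sub_projection_mem cBC (x : U)
    rwa [sub_eq_add_neg] at this
  have hθinj : Function.Injective θ := by
    rw [injective_iff_map_eq_zero]
    intro x hx
    have := hθC x
    rw [hx, add_zero] at this
    exact Subtype.ext (hdj _ _ cAC _ x.2 this)
  have hθrange : LinearMap.range θ = B := by
    apply le_antisymm
    · rintro _ ⟨x, rfl⟩
      exact hθB x
    · intro b hb
      have : b ∈ A ⊔ C := by rw [cAC.sup_eq_top]; trivial
      obtain ⟨x, hx, c, hcC, h⟩ := Submodule.mem_sup.1 this
      refine ⟨-⟨x, hx⟩, ?_⟩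
      have h1 := hθC (-⟨x, hx⟩)
      have h2 := hθB (-⟨x, hx⟩)
      rw [← sub_eq_zero]
      refine hdj _ _ cBC _ (B.sub_mem h2 hb) ?_
      have h4 := C.sub_mem h1 hcC
      have : θ (-⟨x, hx⟩) - b = ((-⟨x, hx⟩ : A) : U) + θ (-⟨x, hx⟩) - c := by
        rw [← h]; push_cast; abel
      rwa [this]
  have hιrange : LinearMap.range A.subtype = A := A.range_subtype
  have hnt : Nontrivial A := Submodule.nontrivial_iff_ne_bot.2 hA1
  obtain ⟨m, -, hm⟩ := (Nat.dvd_prime_pow (Fact.out : p.Prime)).1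
    (hp ▸ (A.toAddSubgroup.card_addSubgroup_dvd_card) : Nat.card A ∣ p ^ n)
  refine cdaux_core p m hm ω halt hmax hc A.subtype θ A.injective_subtype hθinj
    (by rw [hιrange, hθrange]; exact cAB) (fun x y => hA3 y.2 _ x.2)
    (fun x y => hB3 (hθB y) _ (hθB x)) ?_
  intro x y
  have h := hC3 (hθC y) _ (hθC x)
  simp only [map_add, LinearMap.add_apply] at h
  rw [hA3 y.2 _ x.2, hB3 (hθB y) _ (hθB x), zero_add, add_zero, hskew (θ x) y] at h
  exact (neg_add_eq_zero.1 h).symm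

section groups
variable {G : Type*} [Group G] [Finite G]

theorem cdaux_le (H : Subgroup G) : cdMeasure G H ≤ cdMax G :=
  le_csSup (Set.finite_range _).bddAbove ⟨H, rfl⟩

theorem cdaux_card_le {H K : Subgroup G} (h : H ≤ K) : Nat.card H ≤ Nat.card K :=
  Nat.card_le_card_of_injective _ (Subgroup.inclusion_injective h)

theorem cdaux_le_cc {G : Type*} [Group G] (H : Subgroup G) :
    H ≤ Subgroup.centralizer (Subgroup.centralizer (H : Set G) : Set G) := by
  intro x hx
  rw [Subgroup.mem_centralizer_iff]
  intro y hy
  exact ((Subgroup.mem_centralizer_iff.1 hy) x hx).symm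

theorem cdaux_cc {H : Subgroup G} (hH : H ∈ CD G) :
    Subgroup.centralizer (Subgroup.centralizer (H : Set G) : Set G) = H := by
  refine (Subgroup.eq_of_le_of_card_ge (cdaux_le_cc H) ?_).symm
  have h1 := cdaux_le (Subgroup.centralizer (H : Set G))
  rw [← (hH : cdMeasure G H = cdMax G)] at h1
  unfold cdMeasure at h1
  rw [mul_comm (Nat.card H)] at h1
  exact Nat.le_of_mul_le_mul_left h1 Nat.card_pos

theorem cdaux_cent {H : Subgroup G} (hH : H ∈ CD G) :
    Subgroup.centralizer (H : Set G) ∈ CD G := by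
  change cdMeasure G _ = _
  unfold cdMeasure
  rw [cdaux_cc hH, mul_comm]
  exact hH

open scoped Pointwise in
theorem cdaux_mulset (H K : Subgroup G) :
    Nat.card H * Nat.card K ≤
      Nat.card ((H : Set G) * (K : Set G) : Set G) * Nat.card (H ⊓ K : Subgroup G) := by
  rw [← Nat.card_prod, ← Nat.card_prod]
  have hex : ∀ s : ((H : Set G) * (K : Set G) : Set G), ∃ hk : H × K, (hk.1 : G) * hk.2 = s := by
    rintro ⟨_, h, hh, k, hk, rfl⟩
    exact ⟨(⟨h, hh⟩, ⟨k, hk⟩), rfl⟩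
  choose f hf using hex
  refine Nat.card_le_card_of_surjective
    (fun z : ((H : Set G) * (K : Set G) : Set G) × (H ⊓ K : Subgroup G) =>
      (((f z.1).1 * ⟨z.2, z.2.2.1⟩, ⟨z.2, z.2.2.2⟩⁻¹ * (f z.1).2) : H × K)) ?_
  rintro ⟨h, k⟩
  let s : ((H : Set G) * (K : Set G) : Set G) := ⟨h * k, h, h.2, k, k.2, rfl⟩
  have hs : ((f s).1 : G) * (f s).2 = h * k := hf s
  have he : ((f s).1 : G)⁻¹ * h = (f s).2 * (k : G)⁻¹ := by
    rw [inv_mul_eq_iff_eq_mul, ← mul_assoc, hs, mul_inv_cancel_right]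
  refine ⟨(s, ⟨((f s).1 : G)⁻¹ * h, H.mul_mem (H.inv_mem (f s).1.2) h.2, ?_⟩), ?_⟩
  · rw [he]
    exact K.mul_mem (f s).2.2 (K.inv_mem k.2)
  · refine Prod.ext (Subtype.ext ?_) (Subtype.ext ?_)
    · simp
    · change (((f s).1 : G)⁻¹ * h)⁻¹ * (f s).2 = k
      rw [he]; group

open scoped Pointwise in
theorem cdaux_lattice {H K : Subgroup G} (hH : H ∈ CD G) (hK : K ∈ CD G) :
    H ⊓ K ∈ CD G ∧ H ⊔ K ∈ CD G ∧
      ((H ⊔ K : Subgroup G) : Set G) = (H : Set G) * (K : Set G) := by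
  have hH' : Nat.card H * Nat.card (Subgroup.centralizer (H : Set G)) = cdMax G := hH
  have hK' : Nat.card K * Nat.card (Subgroup.centralizer (K : Set G)) = cdMax G := hK
  have h1 := cdaux_mulset H K
  have h2 := cdaux_mulset (Subgroup.centralizer (H : Set G)) (Subgroup.centralizer (K : Set G))
  have hsub : (H : Set G) * (K : Set G) ⊆ ((H ⊔ K : Subgroup G) : Set G) := by
    rintro _ ⟨h, hh, k, hk, rfl⟩
    exact Subgroup.mul_mem_sup hh hk
  have hsub2 : (Subgroup.centralizer (H : Set G) : Set G) * (Subgroup.centralizer (K : Set G) : Set G)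
      ⊆ (Subgroup.centralizer ((H ⊓ K : Subgroup G) : Set G) : Set G) := by
    rintro _ ⟨h, hh, k, hk, rfl⟩
    refine Subgroup.mul_mem _ ?_ ?_
    · exact Subgroup.centralizer_le (fun x hx => hx.1) hh
    · exact Subgroup.centralizer_le (fun x hx => hx.2) hk
  have hle3 : Subgroup.centralizer (H : Set G) ⊓ Subgroup.centralizer (K : Set G) ≤
      Subgroup.centralizer ((H ⊔ K : Subgroup G) : Set G) := by
    rw [Subgroup.le_centralizer_iff, sup_le_iff]
    constructor
    · rw [Subgroup.le_centralizer_iff]; exact inf_le_left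
    · rw [Subgroup.le_centralizer_iff]; exact inf_le_right
  have c1 : Nat.card ((H : Set G) * (K : Set G) : Set G) ≤ Nat.card (H ⊔ K : Subgroup G) :=
    Nat.card_mono (Set.toFinite _) hsub
  have c2 : Nat.card ((Subgroup.centralizer (H : Set G) : Set G) *
      (Subgroup.centralizer (K : Set G) : Set G) : Set G) ≤
      Nat.card (Subgroup.centralizer ((H ⊓ K : Subgroup G) : Set G)) :=
    Nat.card_mono (Set.toFinite _) hsub2
  have c3 := cdaux_card_le hle3
  have m1 := cdaux_le (H ⊓ K)
  have m2 := cdaux_le (H ⊔ K)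
  have hM : 0 < cdMax G := by
    rw [← hH']; exact Nat.mul_pos Nat.card_pos Nat.card_pos
  have p1 : 0 < Nat.card (H ⊓ K : Subgroup G) := Nat.card_pos
  have p2 : 0 < Nat.card (Subgroup.centralizer ((H ⊔ K : Subgroup G) : Set G)) := Nat.card_pos
  have p3 : 0 < Nat.card (Subgroup.centralizer ((H ⊓ K : Subgroup G) : Set G)) := Nat.card_pos
  have q1 : (Nat.card ((H : Set G) * (K : Set G) : Set G) *
      Nat.card (Subgroup.centralizer ((H ⊔ K : Subgroup G) : Set G))) * cdMeasure G (H ⊓ K) ≥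
      cdMax G * cdMax G := by
    calc cdMax G * cdMax G = (Nat.card H * Nat.card K) *
          (Nat.card (Subgroup.centralizer (H : Set G)) *
            Nat.card (Subgroup.centralizer (K : Set G))) := by
          nth_rewrite 1 [← hH']
          rw [← hK']; ring
      _ ≤ _ := Nat.mul_le_mul h1 (h2.trans (Nat.mul_le_mul c2 c3))
      _ = _ := by unfold cdMeasure; ring
  have q2 : Nat.card ((H : Set G) * (K : Set G) : Set G) *
      Nat.card (Subgroup.centralizer ((H ⊔ K : Subgroup G) : Set G)) ≤ cdMeasure G (H ⊔ K) :=
    Nat.mul_le_mul_right _ c1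
  have r1 : cdMeasure G (H ⊓ K) = cdMax G := by
    refine le_antisymm m1 ?_
    by_contra hcon
    push Not at hcon
    nlinarith
  have r3 : cdMax G ≤ Nat.card ((H : Set G) * (K : Set G) : Set G) *
      Nat.card (Subgroup.centralizer ((H ⊔ K : Subgroup G) : Set G)) := by
    rw [r1] at q1
    exact Nat.le_of_mul_le_mul_right q1 hM
  refine ⟨r1, le_antisymm m2 (r3.trans q2), ?_⟩
  refine (Set.eq_of_subset_of_ncard_le hsub ?_ (Set.toFinite _)).symm
  have := m2.trans r3
  exact Nat.le_of_mul_le_mul_right this p2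

theorem cdaux_conj {H : Subgroup G} (hH : H ∈ CD G) (g : G) :
    H.map (MulAut.conj g).toMonoidHom ∈ CD G := by
  have hinj : Function.Injective (MulAut.conj g).toMonoidHom := (MulAut.conj g).injective
  refine le_antisymm (cdaux_le _) ?_
  rw [← (hH : cdMeasure G H = cdMax G)]
  unfold cdMeasure
  have e1 : Nat.card (H.map (MulAut.conj g).toMonoidHom) = Nat.card H :=
    Subgroup.card_map_of_injective hinj
  have e2 : Nat.card ((Subgroup.centralizer (H : Set G)).map (MulAut.conj g).toMonoidHom) =
    Nat.card (Subgroup.centralizer (H : Set G)) := Subgroup.card_map_of_injective hinj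
  rw [e1, ← e2]
  refine Nat.mul_le_mul_left _ (cdaux_card_le ?_)
  rintro _ ⟨c, hc, rfl⟩
  rw [Subgroup.mem_centralizer_iff]
  rintro _ ⟨h, hh, rfl⟩
  rw [← map_mul, ← map_mul, (Subgroup.mem_centralizer_iff.1 hc) h hh]

end groups

universe u in
open scoped IsMulCommutative commutatorElement in
theorem cdaux_quot {M : Type u} [Group M] (hcomm : ∀ x y : M, ⁅x, y⁆ ∈ Subgroup.center M) :
    ∃ (U T : Type u) (_ : AddCommGroup U) (_ : AddCommGroup T) (ω : U →ₗ[ℤ] U →ₗ[ℤ] T)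
      (π : M → U),
      Function.Surjective π ∧ (∀ x y, π (x * y) = π x + π y) ∧
      (∀ x, π x = 0 ↔ x ∈ Subgroup.center M) ∧ ∀ x y, ω (π x) (π y) = 0 ↔ x * y = y * x := by
  have hz : ∀ z ∈ Subgroup.center M, ∀ g, g * z = z * g := fun z hz g =>
    Subgroup.mem_center_iff.1 hz g
  have hl : ∀ x y z : M, ⁅x * y, z⁆ = ⁅x, z⁆ * ⁅y, z⁆ := by
    intro x y z
    have h1 : ⁅x * y, z⁆ = x * ⁅y, z⁆ * (z * x⁻¹ * z⁻¹) := by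
      simp only [commutatorElement_def]; group
    rw [h1, hz _ (hcomm y z), mul_assoc, ← hz _ (hcomm y z)]
    simp only [commutatorElement_def]; group
  have hr : ∀ x y z : M, ⁅x, y * z⁆ = ⁅x, y⁆ * ⁅x, z⁆ := by
    intro x y z
    rw [← commutatorElement_inv, hl, mul_inv_rev, commutatorElement_inv, commutatorElement_inv,
      hz _ (hcomm x y)]
  let ic : CommGroup (M ⧸ Subgroup.center M) :=
    { (inferInstance : Group (M ⧸ Subgroup.center M)) with
      mul_comm := by
        intro a b
        induction a using QuotientGroup.induction_on with | H a => ?_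
        induction b using QuotientGroup.induction_on with | H b => ?_
        rw [← QuotientGroup.mk_mul, ← QuotientGroup.mk_mul, QuotientGroup.eq]
        have := hcomm b⁻¹ a⁻¹
        simp only [commutatorElement_def] at this
        convert this using 1
        group }
  let c : M → (M ⧸ Subgroup.center M) →* Subgroup.center M := fun x =>
    QuotientGroup.lift (Subgroup.center M)
      (MonoidHom.mk' (fun y => (⟨⁅x, y⁆, hcomm x y⟩ : Subgroup.center M))
        (fun y z => Subtype.ext (hr x y z)))
      (fun z hz' => Subtype.ext (commutatorElement_eq_one_iff_mul_comm.2 (hz z hz' x)))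
  have hc : ∀ x y : M, ((c x (y : M ⧸ Subgroup.center M) : Subgroup.center M) : M) = ⁅x, y⁆ :=
    fun x y => rfl
  let d : (M ⧸ Subgroup.center M) →* ((M ⧸ Subgroup.center M) →* Subgroup.center M) :=
    QuotientGroup.lift (Subgroup.center M)
      (MonoidHom.mk' c (fun x y => by
        ext z
        exact hl x y z))
      (fun z hz' => by
        ext y
        exact commutatorElement_eq_one_iff_mul_comm.2 (hz z hz' y).symm)
  have hd : ∀ x y : M, ((d x (y : M ⧸ Subgroup.center M) : Subgroup.center M) : M) = ⁅x, y⁆ :=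
    fun x y => rfl
  let ω : Additive (M ⧸ Subgroup.center M) →ₗ[ℤ] Additive (M ⧸ Subgroup.center M) →ₗ[ℤ]
        Additive (Subgroup.center M) :=
    (AddMonoidHom.mk' (fun u => (MonoidHom.toAdditive (d u.toMul)).toIntLinearMap)
      (fun u v => by
        ext z
        simp)).toIntLinearMap
  refine ⟨_, _, inferInstance, inferInstance, ω, fun x => Additive.ofMul (x : M ⧸ Subgroup.center M), ?_, ?_, ?_, ?_⟩
  · intro u
    obtain ⟨x, hx⟩ := QuotientGroup.mk_surjective u.toMul
    exact ⟨x, congrArg Additive.ofMul hx⟩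
  · intro x y
    rfl
  · intro x
    rw [ofMul_eq_zero, QuotientGroup.eq_one_iff]
  · intro x y
    rw [← commutatorElement_eq_one_iff_mul_comm, ← hd, ← Subgroup.coe_one, Subtype.coe_inj]
    rfl

/-- If `G` is a finite `p`-group whose Chermak–Delgado lattice is a quasi-antichain of
width `w` (a maximum `Mt`, a minimum `Mb`, and `w` atoms, which are pairwise
incomparable) having exactly `t > 2` abelian atoms, then `w = p^a + 1` and
`t = p^b + 1` for positive integers `a`, `b` with `a = b` or `a = 2b`. -/
theorem quasiAntichain_CD_abelian_atoms
    (p : ℕ) [Fact p.Prime] (G : Type*) [Group G] [Fintype G] (hG : IsPGroup p G)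
    (Mt Mb : Subgroup G) (w t : ℕ)
    (hMt : Mt ∈ CD G) (hMb : Mb ∈ CD G) (hlt : Mb < Mt)
    (hbound : ∀ H ∈ CD G, Mb ≤ H ∧ H ≤ Mt)
    (hanti : ∀ H ∈ CD G, ∀ K ∈ CD G,
      H ≠ Mb → H ≠ Mt → K ≠ Mb → K ≠ Mt → H ≤ K → H = K)
    (hw : {H ∈ CD G | H ≠ Mb ∧ H ≠ Mt}.ncard = w)
    (ht : {H ∈ CD G | H ≠ Mb ∧ H ≠ Mt ∧ ∀ x ∈ H, ∀ y ∈ H, x * y = y * x}.ncard = t)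
    (ht2 : 2 < t) :
    ∃ a b : ℕ, 0 < a ∧ 0 < b ∧ w = p ^ a + 1 ∧ t = p ^ b + 1 ∧ (a = b ∨ a = 2 * b) := by
  classical
  have hcMt : Subgroup.centralizer (Mt : Set G) = Mb := by
    apply le_antisymm
    · have h1 := (hbound _ (cdaux_cent hMb)).2
      have h2 := Subgroup.centralizer_le (s := (Subgroup.centralizer (Mb : Set G) : Set G))
        (t := (Mt : Set G)) h1
      rwa [cdaux_cc hMb] at h2
    · exact (hbound _ (cdaux_cent hMt)).1
  have hzMb : ∀ z ∈ Mb, ∀ x ∈ Mt, x * z = z * x := by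
    intro z hz x hx
    rw [← hcMt] at hz
    exact Subgroup.mem_centralizer_iff.1 hz x hx
  have hatoms : ∀ X ∈ CD G, ∀ Y ∈ CD G, X ≠ Mb → X ≠ Mt → Y ≠ Mb → Y ≠ Mt → X ≠ Y →
      X ⊓ Y = Mb ∧ X ⊔ Y = Mt := by
    intro X hX Y hY hX1 hX2 hY1 hY2 hne
    obtain ⟨h1, h2, -⟩ := cdaux_lattice hX hY
    constructor
    · by_contra hcon
      have h3 : X ⊓ Y ≠ Mt := by
        intro h
        exact hX2 (le_antisymm (hbound X hX).2 (h ▸ inf_le_left))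
      have e1 := hanti _ h1 X hX hcon h3 hX1 hX2 inf_le_left
      have e2 := hanti _ h1 Y hY hcon h3 hY1 hY2 inf_le_right
      exact hne (e1.symm.trans e2)
    · by_contra hcon
      have h3 : X ⊔ Y ≠ Mb := by
        intro h
        exact hX1 (le_antisymm (h ▸ le_sup_left) (hbound X hX).1)
      have e1 := hanti X hX _ h2 hX1 hX2 h3 hcon le_sup_left
      have e2 := hanti Y hY _ h2 hY1 hY2 h3 hcon le_sup_right
      exact hne (e1.trans e2.symm)
  have hnorm : ∀ X ∈ CD G, X ≠ Mb → X ≠ Mt → ∀ g ∈ Mt, ∀ x ∈ X, g * x * g⁻¹ ∈ X := by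
    intro X hX hX1 hX2 g hg x hx
    have hY := cdaux_conj hX g
    set Y := X.map (MulAut.conj g).toMonoidHom with hYdef
    have hcard : Nat.card Y = Nat.card X :=
      Subgroup.card_map_of_injective (MulAut.conj g).injective
    have hmem : ∀ x ∈ X, g * x * g⁻¹ ∈ Y := fun x hx => ⟨x, hx, rfl⟩
    by_cases hXY : X = Y
    · rw [hXY]; exact hmem x hx
    · have hY1 : Y ≠ Mb := by
        intro h
        apply hX1
        refine (Subgroup.eq_of_le_of_card_ge (hbound X hX).1 ?_).symm
        rw [← hcard, h]
      have hY2 : Y ≠ Mt := by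
        intro h
        apply hX2
        refine Subgroup.eq_of_le_of_card_ge (hbound X hX).2 ?_
        rw [← hcard, h]
      have hs := (hatoms X hX Y hY hX1 hX2 hY1 hY2 hXY).2
      have hset := (cdaux_lattice hX hY).2.2
      rw [hs] at hset
      have hg' : g⁻¹ ∈ (Mt : Set G) := Mt.inv_mem hg
      rw [hset] at hg'
      obtain ⟨a, ha, _, ⟨b, hb, rfl⟩, he⟩ := hg'
      have he' : a * (g * b * g⁻¹) = g⁻¹ := he
      have : g = a⁻¹ * b⁻¹ := by
        have h1 : a * g * b = 1 := by
          have := congrArg (· * g) he'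
          simpa [mul_assoc] using this
        rw [eq_inv_mul_iff_mul_eq, ← mul_eq_one_iff_eq_inv]
        exact h1
      have hgX : g ∈ X := by
        rw [this]; exact X.mul_mem (X.inv_mem ha) (X.inv_mem hb)
      exact X.mul_mem (X.mul_mem hgX hx) (X.inv_mem hgX)
  -- `Mt` has class at most two
  have hclass : ∀ x ∈ Mt, ∀ y ∈ Mt, x * y * x⁻¹ * y⁻¹ ∈ Mb := by
    have h3 := ht2
    rw [← ht] at h3
    obtain ⟨A, ⟨hA, hA1, hA2, hA3⟩, B, ⟨hB, hB1, hB2, hB3⟩, C, -, hAB, -, -⟩ :=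
      (Set.two_lt_ncard (Set.toFinite _)).1 h3
    obtain ⟨hi, hs⟩ := hatoms A hA B hB hA1 hA2 hB1 hB2 hAB
    have hset := (cdaux_lattice hA hB).2.2
    rw [hs] at hset
    have hAM := (hbound A hA).2
    have hBM := (hbound B hB).2
    -- the elements of `Mt` whose commutators with a given subset lie in `Mb`
    have hmb : ∀ g ∈ Mt, ∀ z ∈ Mb, g * z * g⁻¹ ∈ Mb := fun g hg z hz => by
      rw [hzMb z hz g hg, mul_inv_cancel_right]; exact hz
    have key1 : ∀ y ∈ Mt, ∀ x ∈ Mt, ∀ x' ∈ Mt, x * y * x⁻¹ * y⁻¹ ∈ Mb → x' * y * x'⁻¹ * y⁻¹ ∈ Mb →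
        (x * x') * y * (x * x')⁻¹ * y⁻¹ ∈ Mb := by
      intro y hy x hx x' hx' h h'
      have : (x * x') * y * (x * x')⁻¹ * y⁻¹ =
        (x * (x' * y * x'⁻¹ * y⁻¹) * x⁻¹) * (x * y * x⁻¹ * y⁻¹) := by group
      rw [this]
      exact Mb.mul_mem (hmb x hx _ h') h
    have key2 : ∀ x y, x * y * x⁻¹ * y⁻¹ ∈ Mb → y * x * y⁻¹ * x⁻¹ ∈ Mb := by
      intro x y h
      have : y * x * y⁻¹ * x⁻¹ = (x * y * x⁻¹ * y⁻¹)⁻¹ := by group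
      rw [this]; exact Mb.inv_mem h
    have kAB : ∀ a ∈ A, ∀ b ∈ B, a * b * a⁻¹ * b⁻¹ ∈ Mb := by
      intro a ha b hb
      rw [← hi]
      constructor
      · have := A.mul_mem ha (hnorm A hA hA1 hA2 b (hBM hb) _ (A.inv_mem ha))
        simpa [mul_assoc] using this
      · exact B.mul_mem (hnorm B hB hB1 hB2 a (hAM ha) _ hb) (B.inv_mem hb)
    have kAA : ∀ X : Subgroup G, (∀ x ∈ X, ∀ y ∈ X, x * y = y * x) →
        ∀ a ∈ X, ∀ b ∈ X, a * b * a⁻¹ * b⁻¹ ∈ Mb := by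
      intro X hX a ha b hb
      rw [hX a ha b hb]
      simp
    have hAll : ∀ S : Set G, S ⊆ Mt → (∀ y ∈ S, ∀ a ∈ A, a * y * a⁻¹ * y⁻¹ ∈ Mb) →
        (∀ y ∈ S, ∀ b ∈ B, b * y * b⁻¹ * y⁻¹ ∈ Mb) →
        ∀ y ∈ S, ∀ x ∈ Mt, x * y * x⁻¹ * y⁻¹ ∈ Mb := by
      intro S hS h1 h2 y hy x hx
      have hx' : x ∈ (Mt : Set G) := hx
      rw [hset] at hx'
      obtain ⟨a, ha, b, hb, rfl⟩ := hx'
      exact key1 y (hS hy) a (hAM ha) b (hBM hb) (h1 y hy a ha) (h2 y hy b hb)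
    have kA := hAll A hAM (fun y hy a ha => kAA A hA3 a ha y hy)
      (fun y hy b hb => key2 _ _ (kAB y hy b hb))
    have kB := hAll B hBM (fun y hy a ha => kAB a ha y hy)
      (fun y hy b hb => kAA B hB3 b hb y hy)
    have kM := hAll Mt (fun x hx => hx) (fun y hy a ha => key2 _ _ (kA a ha y hy))
      (fun y hy a ha => key2 _ _ (kB a ha y hy))
    exact fun x hx y hy => kM y hy x hx
  have hcen : ∀ x : Mt, x ∈ Subgroup.center Mt ↔ (x : G) ∈ Mb := by
    intro x
    rw [Subgroup.mem_center_iff]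
    constructor
    · intro h
      rw [← hcMt, Subgroup.mem_centralizer_iff]
      intro y hy
      exact congrArg Subtype.val (h ⟨y, hy⟩)
    · intro h y
      exact Subtype.ext (hzMb x h y y.2)
  obtain ⟨U, T, _, _, ω, π, hπs, hπm, hπ0, hπω⟩ :=
    cdaux_quot (M := Mt) (fun x y => (hcen _).2 (hclass x x.2 y y.2))
  have hfinU : Finite U := Finite.of_surjective π hπs
  have hπ1 : π 1 = 0 := (hπ0 1).2 (Subgroup.one_mem _)
  have hπinv : ∀ x, π x⁻¹ = - π x := fun x => by
    rw [eq_neg_iff_add_eq_zero, ← hπm, inv_mul_cancel, hπ1]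
  have halt : ∀ u, ω u u = 0 := by
    intro u
    obtain ⟨x, rfl⟩ := hπs u
    exact (hπω x x).2 rfl
  let Φ : Submodule ℤ U → Subgroup G := fun K =>
    { carrier := {g | ∃ h : g ∈ Mt, π ⟨g, h⟩ ∈ K}
      mul_mem' := by
        rintro a b ⟨ha, ha'⟩ ⟨hb, hb'⟩
        refine ⟨Mt.mul_mem ha hb, ?_⟩
        have := K.add_mem ha' hb'
        rwa [← hπm] at this
      one_mem' := ⟨Mt.one_mem, by
        have := K.zero_mem
        rwa [← hπ1] at this⟩
      inv_mem' := by
        rintro a ⟨ha, ha'⟩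
        refine ⟨Mt.inv_mem ha, ?_⟩
        have := K.neg_mem ha'
        rwa [← hπinv] at this }
  have hΦmem : ∀ K g, g ∈ Φ K ↔ ∃ h : g ∈ Mt, π ⟨g, h⟩ ∈ K := fun K g => Iff.rfl
  have hΦle : ∀ K, Φ K ≤ Mt := fun K g hg => hg.1
  have hΦmb : ∀ K, Mb ≤ Φ K := by
    intro K g hg
    have hg' : g ∈ Mt := hlt.le hg
    refine ⟨hg', ?_⟩
    rw [(hπ0 ⟨g, hg'⟩).2 ((hcen _).2 hg)]
    exact K.zero_mem
  have hΦle_iff : ∀ K K', Φ K ≤ Φ K' ↔ K ≤ K' := by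
    intro K K'
    constructor
    · intro h u hu
      obtain ⟨x, rfl⟩ := hπs u
      exact (h ((hΦmem K x).2 ⟨x.2, hu⟩)).2
    · rintro h g ⟨hg, hg'⟩
      exact ⟨hg, h hg'⟩
  have hΦinj : Function.Injective Φ := fun K K' h =>
    le_antisymm ((hΦle_iff _ _).1 h.le) ((hΦle_iff _ _).1 h.ge)
  have hΦtop : Φ ⊤ = Mt := le_antisymm (hΦle _) (fun g hg => ⟨hg, trivial⟩)
  have hΦbot : Φ ⊥ = Mb := by
    refine le_antisymm ?_ (hΦmb _)
    rintro g ⟨hg, hg'⟩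
    exact (hcen _).1 ((hπ0 _).1 ((Submodule.mem_bot _).1 hg'))
  have hΦsurj : ∀ H : Subgroup G, Mb ≤ H → H ≤ Mt → ∃ K, Φ K = H := by
    intro H h1 h2
    let K0 : AddSubgroup U :=
      { carrier := {u | ∃ x : Mt, (x : G) ∈ H ∧ π x = u}
        add_mem' := by
          rintro _ _ ⟨x, hx, rfl⟩ ⟨y, hy, rfl⟩
          exact ⟨x * y, H.mul_mem hx hy, hπm x y⟩
        zero_mem' := ⟨1, H.one_mem, hπ1⟩
        neg_mem' := by
          rintro _ ⟨x, hx, rfl⟩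
          exact ⟨x⁻¹, H.inv_mem hx, hπinv x⟩ }
    refine ⟨AddSubgroup.toIntSubmodule K0, le_antisymm ?_ ?_⟩
    · rintro g ⟨hg, x, hx, hxg⟩
      have h0 : π (x⁻¹ * ⟨g, hg⟩) = 0 := by
        rw [hπm, hπinv, hxg, neg_add_cancel]
      have h5 := h1 ((hcen _).1 ((hπ0 _).1 h0))
      have h6 := H.mul_mem hx h5
      simpa using h6
    · intro g hg
      exact ⟨h2 hg, ⟨g, h2 hg⟩, hg, rfl⟩
  have hΦcard : ∀ K, Nat.card (Φ K) = Nat.card K * Nat.card Mb := by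
    intro K
    let f : Φ K →* Multiplicative K :=
      MonoidHom.mk' (fun g => Multiplicative.ofAdd ⟨π ⟨g, g.2.1⟩, g.2.2⟩) (fun a b => by
        apply Multiplicative.toAdd.injective
        apply Subtype.ext
        exact hπm ⟨a, a.2.1⟩ ⟨b, b.2.1⟩)
    have hf : ∀ g : Φ K, f g = 1 ↔ (g : G) ∈ Mb := by
      intro g
      have e1 : f g = 1 ↔ π ⟨g, g.2.1⟩ = 0 := by
        constructor
        · intro h
          exact congrArg (fun z : Multiplicative K => ((Multiplicative.toAdd z : K) : U)) h
        · intro h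
          apply Multiplicative.toAdd.injective
          exact Subtype.ext h
      rw [e1, hπ0, hcen]
    have hsurj : Function.Surjective f := by
      intro k
      obtain ⟨x, hx⟩ := hπs (Multiplicative.toAdd k : K)
      refine ⟨⟨x, x.2, ?_⟩, ?_⟩
      · change π x ∈ K
        rw [hx]; exact (Multiplicative.toAdd k : K).2
      · apply Multiplicative.toAdd.injective
        exact Subtype.ext hx
    have hker : Nat.card f.ker = Nat.card Mb :=
      Nat.card_congr
        { toFun := fun g => ⟨g, (hf _).1 g.2⟩
          invFun := fun g => ⟨⟨g, hΦmb K g.2⟩, (hf _).2 g.2⟩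
          left_inv := fun _ => rfl
          right_inv := fun _ => rfl }
    have h1 := f.ker.card_mul_index
    rw [Subgroup.index_ker, MonoidHom.range_eq_top.2 hsurj, Subgroup.card_top, hker] at h1
    rw [← h1, mul_comm]
    rfl
  have hΦperp : ∀ K, Φ (cdPerp ω K) = Subgroup.centralizer (Φ K : Set G) ⊓ Mt := by
    intro K
    ext g
    constructor
    · rintro ⟨hg, hg'⟩
      refine ⟨?_, hg⟩
      change g ∈ Subgroup.centralizer (Φ K : Set G)
      rw [Subgroup.mem_centralizer_iff]
      rintro x ⟨hx, hx'⟩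
      exact congrArg Subtype.val ((hπω ⟨x, hx⟩ ⟨g, hg⟩).1 (hg' _ hx'))
    · rintro ⟨hg1, hg⟩
      refine ⟨hg, ?_⟩
      intro u hu
      obtain ⟨x, rfl⟩ := hπs u
      refine (hπω _ _).2 (Subtype.ext ?_)
      exact (Subgroup.mem_centralizer_iff.1 hg1) x ((hΦmem K x).2 ⟨x.2, hu⟩)
  have hctop : Nat.card (⊤ : Submodule ℤ U) = Nat.card U :=
    Nat.card_congr Submodule.topEquiv.toEquiv
  have hmaxeq : cdMax G = Nat.card U * Nat.card Mb * Nat.card Mb := by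
    rw [← (hMt : cdMeasure G Mt = cdMax G)]
    unfold cdMeasure
    rw [hcMt, ← hctop, ← hΦcard ⊤, hΦtop]
  have hbpos : 0 < Nat.card Mb * Nat.card Mb := Nat.mul_pos Nat.card_pos Nat.card_pos
  have hmle : ∀ K : Submodule ℤ U, Nat.card K * Nat.card (cdPerp ω K) * (Nat.card Mb * Nat.card Mb) ≤
      cdMeasure G (Φ K) := by
    intro K
    have h1 : Nat.card (Φ (cdPerp ω K)) ≤ Nat.card (Subgroup.centralizer (Φ K : Set G)) :=
      cdaux_card_le (by rw [hΦperp]; exact inf_le_left)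
    unfold cdMeasure
    calc _ = Nat.card (Φ K) * Nat.card (Φ (cdPerp ω K)) := by
          rw [hΦcard, hΦcard]; ring
      _ ≤ _ := Nat.mul_le_mul_left _ h1
  have hmax : ∀ K : Submodule ℤ U, Nat.card K * Nat.card (cdPerp ω K) ≤ Nat.card U := by
    intro K
    have h1 := (hmle K).trans (cdaux_le _)
    rw [hmaxeq, mul_assoc (Nat.card U)] at h1
    exact Nat.le_of_mul_le_mul_right h1 hbpos
  have hL : ∀ K : Submodule ℤ U, Φ K ∈ CD G ↔ Nat.card K * Nat.card (cdPerp ω K) = Nat.card U := by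
    intro K
    constructor
    · intro h
      have h1 := (hbound _ (cdaux_cent h)).2
      have h2 : Φ (cdPerp ω K) = Subgroup.centralizer (Φ K : Set G) := by
        rw [hΦperp, inf_eq_left]; exact h1
      have h3 : cdMeasure G (Φ K) = cdMax G := h
      unfold cdMeasure at h3
      rw [← h2, hΦcard, hΦcard, hmaxeq] at h3
      refine Nat.eq_of_mul_eq_mul_right hbpos ?_
      rw [← mul_assoc (Nat.card U), ← h3]; ring
    · intro h
      refine le_antisymm (cdaux_le _) ?_
      have := hmle K
      rw [h, ← mul_assoc, ← hmaxeq] at this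
      exact this
  have hΦne : ∀ K, (Φ K ≠ Mb ↔ K ≠ ⊥) ∧ (Φ K ≠ Mt ↔ K ≠ ⊤) := by
    intro K
    rw [← hΦbot, ← hΦtop, hΦinj.ne_iff, hΦinj.ne_iff]
    exact ⟨Iff.rfl, Iff.rfl⟩
  have hab : ∀ K, (∀ x ∈ Φ K, ∀ y ∈ Φ K, x * y = y * x) ↔ K ≤ cdPerp ω K := by
    intro K
    rw [← hΦle_iff, hΦperp, le_inf_iff]
    constructor
    · intro h
      refine ⟨fun y hy => ?_, hΦle K⟩
      rw [Subgroup.mem_centralizer_iff]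
      exact fun x hx => h x hx y hy
    · rintro ⟨h, -⟩ x hx y hy
      exact (Subgroup.mem_centralizer_iff.1 (h hy)) x hx
  have hc : ∀ K K' : Submodule ℤ U, Nat.card K * Nat.card (cdPerp ω K) = Nat.card U →
      Nat.card K' * Nat.card (cdPerp ω K') = Nat.card U → K ≠ ⊥ → K ≠ ⊤ → K' ≠ ⊥ → K' ≠ ⊤ →
      K ≠ K' → IsCompl K K' := by
    intro K K' h h' h1 h2 h3 h4 hne
    obtain ⟨e1, e2⟩ := hatoms (Φ K) ((hL K).2 h) (Φ K') ((hL K').2 h') ((hΦne K).1.2 h1)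
      ((hΦne K).2.2 h2) ((hΦne K').1.2 h3) ((hΦne K').2.2 h4) (hΦinj.ne hne)
    rw [isCompl_iff, disjoint_iff, codisjoint_iff]
    constructor
    · apply hΦinj
      rw [hΦbot]
      refine le_antisymm ?_ (hΦmb _)
      rw [← e1]
      exact le_inf ((hΦle_iff _ _).2 inf_le_left) ((hΦle_iff _ _).2 inf_le_right)
    · apply hΦinj
      rw [hΦtop]
      refine le_antisymm (hΦle _) ?_
      rw [← e2]
      exact sup_le ((hΦle_iff _ _).2 le_sup_left) ((hΦle_iff _ _).2 le_sup_right)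
  have hset1 : {H ∈ CD G | H ≠ Mb ∧ H ≠ Mt} =
      Φ '' {K : Submodule ℤ U | Nat.card K * Nat.card (cdPerp ω K) = Nat.card U ∧
        K ≠ ⊥ ∧ K ≠ ⊤} := by
    ext H
    constructor
    · rintro ⟨hH, h1, h2⟩
      obtain ⟨K, rfl⟩ := hΦsurj H (hbound H hH).1 (hbound H hH).2
      exact ⟨K, ⟨(hL K).1 hH, (hΦne K).1.1 h1, (hΦne K).2.1 h2⟩, rfl⟩
    · rintro ⟨K, ⟨hK, h1, h2⟩, rfl⟩
      exact ⟨(hL K).2 hK, (hΦne K).1.2 h1, (hΦne K).2.2 h2⟩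
  have hset2 : {H ∈ CD G | H ≠ Mb ∧ H ≠ Mt ∧ ∀ x ∈ H, ∀ y ∈ H, x * y = y * x} =
      Φ '' {K : Submodule ℤ U | Nat.card K * Nat.card (cdPerp ω K) = Nat.card U ∧
        K ≠ ⊥ ∧ K ≠ ⊤ ∧ K ≤ cdPerp ω K} := by
    ext H
    constructor
    · rintro ⟨hH, h1, h2, h3⟩
      obtain ⟨K, rfl⟩ := hΦsurj H (hbound H hH).1 (hbound H hH).2
      exact ⟨K, ⟨(hL K).1 hH, (hΦne K).1.1 h1, (hΦne K).2.1 h2, (hab K).1 h3⟩, rfl⟩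
    · rintro ⟨K, ⟨hK, h1, h2, h3⟩, rfl⟩
      exact ⟨(hL K).2 hK, (hΦne K).1.2 h1, (hΦne K).2.2 h2, (hab K).2 h3⟩
  rw [hset1, Set.ncard_image_of_injective _ hΦinj] at hw
  rw [hset2, Set.ncard_image_of_injective _ hΦinj] at ht
  have hUp : ∃ n, Nat.card U = p ^ n := by
    obtain ⟨n, hn⟩ := (IsPGroup.iff_card.1 (hG.to_subgroup Mt))
    have h1 : Nat.card U ∣ p ^ n := by
      rw [← hn, ← hΦtop, hΦcard, hctop]
      exact Dvd.intro _ rfl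
    obtain ⟨m, -, hm⟩ := (Nat.dvd_prime_pow (Fact.out : p.Prime)).1 h1
    exact ⟨m, hm⟩
  obtain ⟨n, hn⟩ := hUp
  obtain ⟨a, b, ha, hb, h1, h2, h3⟩ := cdaux_lin p n hn ω halt hmax hc (by rw [ht]; exact ht2)
  exact ⟨a, b, ha, hb, hw.symm.trans h1, ht.symm.trans h2, h3⟩
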